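/- For all τ ∈ ℂ with Im τ > 0, θ'[1/3; 1/3](0,τ) · θ[1/3; 1/3](0,τ)² = −(π/3) · θ[1/2; 0](0,τ) · θ[0; 1/2](0,τ) · θ[1/6; 1/6](0,τ)³, where in [ε'; ε] the first entry is the top characteristic ε' and the second is the bottom characteristic ε. -/

import Mathlib

open Complex

/-- The theta function with characteristic `[ε'; ε]`:
`θ[ε';ε](z,τ) = Σ_{n∈ℤ} exp(πi(n+ε')²τ + 2πi(n+ε')(z+ε))`. -/
noncomputable def jacobiThetaChar (ε' ε : ℝ) (z τ : ℂ) : ℂ :=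
  ∑' n : ℤ, Complex.exp ((Real.pi : ℂ) * Complex.I * ((n : ℂ) + (ε' : ℂ)) ^ 2 * τ +
    2 * (Real.pi : ℂ) * Complex.I * ((n : ℂ) + (ε' : ℂ)) * (z + (ε : ℂ)))

/-- The theta derivative `θ'[ε';ε](0,τ) = ∂_z θ[ε';ε](z,τ) |_{z=0}`. -/
noncomputable def jacobiThetaCharDeriv (ε' ε : ℝ) (τ : ℂ) : ℂ :=
  deriv (fun z => jacobiThetaChar ε' ε z τ) 0

lemma cexp_pi_I_half : cexp (Real.pi * I * (1/2)) = I := by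
  rw [show (Real.pi : ℂ) * I * (1 / 2) = Real.pi / 2 * I by ring, Complex.exp_mul_I]
  simp

/-- parity equivalence -/
noncomputable def parEquiv : (ℤ × ℤ) ⊕ (ℤ × ℤ) ≃ ℤ × ℤ :=
  Equiv.ofBijective
    (Sum.elim (fun p => (p.1 + p.2, p.1 - p.2)) (fun p => (p.1 + p.2 + 1, p.1 - p.2)))
    (by
      constructor
      · rintro (⟨a, b⟩ | ⟨a, b⟩) (⟨c, d⟩ | ⟨c, d⟩) h <;>
          simp only [Sum.elim_inl, Sum.elim_inr, Prod.mk.injEq] at h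
        · have h1 : a = c := by omega
          have h2 : b = d := by omega
          rw [h1, h2]
        · omega
        · omega
        · have h1 : a = c := by omega
          have h2 : b = d := by omega
          rw [h1, h2]
      · rintro ⟨n, m⟩
        rcases Int.even_or_odd (n + m) with ⟨k, hk⟩ | ⟨k, hk⟩
        · refine ⟨Sum.inl (k, n - k), ?_⟩
          simp only [Sum.elim_inl, Prod.mk.injEq]
          omega
        · refine ⟨Sum.inr (k, n - k - 1), ?_⟩
          simp only [Sum.elim_inr, Prod.mk.injEq]
          omega)

lemma parEquiv_inl (p : ℤ × ℤ) : parEquiv (Sum.inl p) = (p.1 + p.2, p.1 - p.2) := rfl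
lemma parEquiv_inr (p : ℤ × ℤ) : parEquiv (Sum.inr p) = (p.1 + p.2 + 1, p.1 - p.2) := rfl

lemma theta_prod (x y τ : ℂ) (hτ : 0 < τ.im) :
    jacobiTheta₂ (x + y) τ * jacobiTheta₂ (x - y) τ =
      jacobiTheta₂ (2 * x) (2 * τ) * jacobiTheta₂ (2 * y) (2 * τ) +
      cexp (Real.pi * I * (τ + 2 * x + 2 * y)) *
        (jacobiTheta₂ (2 * x + τ) (2 * τ) * jacobiTheta₂ (2 * y + τ) (2 * τ)) := by
  have hτ2 : 0 < (2 * τ).im := by simpa using hτ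
  have S := fun (z : ℂ) => ((summable_jacobiTheta₂_term_iff z τ).2 hτ).norm
  have S2 := fun (z : ℂ) => ((summable_jacobiTheta₂_term_iff z (2 * τ)).2 hτ2).norm
  unfold jacobiTheta₂
  rw [tsum_mul_tsum_of_summable_norm (S _) (S _), tsum_mul_tsum_of_summable_norm (S2 _) (S2 _),
    tsum_mul_tsum_of_summable_norm (S2 _) (S2 _), ← tsum_mul_left, ← parEquiv.tsum_eq]
  have s0 := summable_mul_of_summable_norm (S (x + y)) (S (x - y))
  have s1 := parEquiv.summable_iff.2 s0
  refine (Summable.tsum_sum (s1.comp_injective Sum.inl_injective)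
    (s1.comp_injective Sum.inr_injective)).trans ?_
  congr 1
  · refine tsum_congr fun p => ?_
    simp only [Function.comp_apply, parEquiv_inl, jacobiTheta₂_term,
      ← Complex.exp_add]
    congr 1
    push_cast
    ring
  · refine tsum_congr fun p => ?_
    simp only [Function.comp_apply, parEquiv_inr, jacobiTheta₂_term,
      ← Complex.exp_add]
    congr 1
    push_cast
    ring

/-- odd theta function -/
noncomputable def thU (τ u : ℂ) : ℂ :=
  cexp (Real.pi * I * (τ / 4 + u)) * jacobiTheta₂ (u + (1 + τ) / 2) τ

lemma thU_neg (τ u : ℂ) : thU τ (-u) = - thU τ u := by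
  unfold thU
  have h1 : jacobiTheta₂ (u + (1 + τ) / 2) τ = jacobiTheta₂ (-u - (1 + τ) / 2) τ := by
    rw [← jacobiTheta₂_neg_left]; congr 1; ring
  have h2 : -u + (1 + τ) / 2 = (-u - (1 + τ) / 2 + τ) + 1 := by ring
  rw [h1, h2, jacobiTheta₂_add_left, jacobiTheta₂_add_left', ← mul_assoc, ← Complex.exp_add,
    ← neg_mul]
  congr 1
  rw [show Real.pi * I * (τ / 4 + -u) + -Real.pi * I * (τ + 2 * (-u - (1 + τ) / 2)) =
    Real.pi * I * (τ / 4 + u) + Real.pi * I by ring, Complex.exp_add, Complex.exp_pi_mul_I]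
  ring

lemma thU_zero (τ : ℂ) : thU τ 0 = 0 := by
  have := thU_neg τ 0
  rw [neg_zero] at this
  linear_combination this / 2

lemma theta_half_zero (τ : ℂ) : jacobiTheta₂ ((1 + τ) / 2) τ = 0 := by
  have := thU_zero τ
  unfold thU at this
  simpa using this

noncomputable def thA (τ x : ℂ) : ℂ := jacobiTheta₂ (2 * x) (2 * τ)
noncomputable def thB (τ x : ℂ) : ℂ :=
  cexp (Real.pi * I * (τ / 2 + 2 * x)) * jacobiTheta₂ (2 * x + τ) (2 * τ)

lemma thU_mul (τ x y : ℂ) (hτ : 0 < τ.im) :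
    thU τ (x + y) * thU τ (x - y) = thB τ x * thA τ y - thA τ x * thB τ y := by
  have h := theta_prod (x + (1 + τ) / 2) y τ hτ
  have e1 : 2 * (x + (1 + τ) / 2) = (2 * x + τ) + 1 := by ring
  have e2 : 2 * x + τ + 1 + τ = (2 * x + 2 * τ) + 1 := by ring
  rw [e1, e2, jacobiTheta₂_add_left, jacobiTheta₂_add_left, jacobiTheta₂_add_left'] at h
  unfold thU thA thB
  rw [show x + y + (1 + τ) / 2 = x + (1 + τ) / 2 + y by ring,
    show x - y + (1 + τ) / 2 = x + (1 + τ) / 2 - y by ring]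
  have E1 : cexp (Real.pi * I * (τ / 4 + (x + y))) * cexp (Real.pi * I * (τ / 4 + (x - y))) =
      cexp (Real.pi * I * (τ / 2 + 2 * x)) := by
    rw [← Complex.exp_add]; congr 1; ring
  have E2 : cexp (Real.pi * I * (τ / 2 + 2 * x)) *
      (cexp (Real.pi * I * (τ + (2 * x + τ + 1) + 2 * y)) *
      cexp (-Real.pi * I * (2 * τ + 2 * (2 * x)))) = - cexp (Real.pi * I * (τ / 2 + 2 * y)) := by
    rw [← Complex.exp_add, ← Complex.exp_add]
    rw [show Real.pi * I * (τ / 2 + 2 * x) + (Real.pi * I * (τ + (2 * x + τ + 1) + 2 * y) +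
      -Real.pi * I * (2 * τ + 2 * (2 * x))) = Real.pi * I * (τ / 2 + 2 * y) + Real.pi * I by ring,
      Complex.exp_add, Complex.exp_pi_mul_I]
    ring
  linear_combination (cexp (Real.pi * I * (τ / 4 + (x + y))) *
    cexp (Real.pi * I * (τ / 4 + (x - y)))) * h +
    (jacobiTheta₂ (2 * x + τ) (2 * τ) * jacobiTheta₂ (2 * y) (2 * τ) +
    (cexp (Real.pi * I * (τ + (2 * x + τ + 1) + 2 * y)) *
      cexp (-Real.pi * I * (2 * τ + 2 * (2 * x)))) * (jacobiTheta₂ (2 * x) (2 * τ) *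
      jacobiTheta₂ (2 * y + τ) (2 * τ))) * E1 +
    jacobiTheta₂ (2 * x) (2 * τ) * jacobiTheta₂ (2 * y + τ) (2 * τ) * E2

lemma thU_plucker (τ t x : ℂ) (hτ : 0 < τ.im) :
    thU τ x ^ 2 * (thU τ (3 * t) * thU τ t) +
      thU τ (x + 2 * t) * thU τ (x - 2 * t) * thU τ t ^ 2 -
      thU τ (x + t) * thU τ (x - t) * thU τ (2 * t) ^ 2 = 0 := by
  have h1 := thU_mul τ x 0 hτ
  have h2 := thU_mul τ (2 * t) t hτ
  have h3 := thU_mul τ x (2 * t) hτ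
  have h4 := thU_mul τ t 0 hτ
  have h5 := thU_mul τ x t hτ
  have h6 := thU_mul τ (2 * t) 0 hτ
  rw [add_zero, sub_zero] at h1 h4 h6
  rw [show 2 * t + t = 3 * t by ring, show 2 * t - t = t by ring] at h2
  rw [h2, h3, h5, pow_two, pow_two, pow_two, h1, h4, h6]
  ring

lemma thU_diff (τ u : ℂ) (hτ : 0 < τ.im) : HasDerivAt (thU τ) (deriv (thU τ) u) u := by
  apply DifferentiableAt.hasDerivAt
  unfold thU
  have := fun z => differentiableAt_jacobiTheta₂_fst z hτ
  have h2 : DifferentiableAt ℂ (fun u => jacobiTheta₂ (u + (1 + τ) / 2) τ) u :=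
    ((this (u + (1 + τ) / 2)).hasDerivAt.comp_add_const u ((1 + τ) / 2)).differentiableAt
  fun_prop

lemma thU_deriv_neg (τ u : ℂ) (hτ : 0 < τ.im) : deriv (thU τ) (-u) = deriv (thU τ) u := by
  have h : (fun v => thU τ (-v)) = fun v => - thU τ v := funext fun v => thU_neg τ v
  have h1 := (thU_diff τ (-u) hτ).scomp u (hasDerivAt_neg u)
  have h2 := (thU_diff τ u hτ).neg
  have h3 : HasDerivAt (fun v => - thU τ v) ((-1 : ℂ) • deriv (thU τ) (-u)) u := by
    rw [← h]; exact h1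
  have := h3.unique h2
  simpa using this

lemma thU_key (τ t : ℂ) (hτ : 0 < τ.im) :
    thU τ t ^ 2 * (3 * deriv (thU τ) t * thU τ (3 * t) - deriv (thU τ) (3 * t) * thU τ t) =
      thU τ (2 * t) ^ 3 * deriv (thU τ) 0 := by
  have D : ∀ c, HasDerivAt (fun x => thU τ (x + c)) (deriv (thU τ) (t + c)) t := fun c =>
    (thU_diff τ (t + c) hτ).comp_add_const t c
  have D' : ∀ c, HasDerivAt (fun x => thU τ (x - c)) (deriv (thU τ) (t - c)) t := fun c =>
    (thU_diff τ (t - c) hτ).comp_sub_const t c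
  have H := ((((thU_diff τ t hτ).pow 2).mul_const (thU τ (3 * t) * thU τ t)).add
    (((D (2 * t)).mul (D' (2 * t))).mul_const (thU τ t ^ 2))).sub
    (((D t).mul (D' t)).mul_const (thU τ (2 * t) ^ 2))
  have Z : HasDerivAt (fun _ : ℂ => (0 : ℂ)) 0 t := hasDerivAt_const _ _
  have := H.unique (Z.congr_of_eventuallyEq (Filter.Eventually.of_forall fun x =>
    thU_plucker τ t x hτ))
  simp only [sub_self, thU_zero, show t + 2 * t = 3 * t by ring, show t - 2 * t = -t by ring,
    show t + t = 2 * t by ring, thU_neg, thU_deriv_neg τ t hτ] at this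
  linear_combination this

lemma thU_deriv_half (τ : ℂ) (hτ : 0 < τ.im) :
    deriv (thU τ) ((1 + τ) / 2) = - (Real.pi * I) * thU τ ((1 + τ) / 2) := by
  have h : ∀ s, thU τ (s + (1 + τ) / 2) =
      cexp (-2 * Real.pi * I * s) * thU τ ((1 + τ) / 2 - s) := by
    intro s
    unfold thU
    rw [show s + (1 + τ) / 2 + (1 + τ) / 2 = s + τ + 1 by ring,
      show (1 + τ) / 2 - s + (1 + τ) / 2 = -s + τ + 1 by ring, jacobiTheta₂_add_left,
      jacobiTheta₂_add_left, jacobiTheta₂_add_left', jacobiTheta₂_add_left',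
      jacobiTheta₂_neg_left, ← mul_assoc, ← mul_assoc, ← mul_assoc, ← Complex.exp_add,
      ← Complex.exp_add, ← Complex.exp_add]
    congr 2
    ring
  have D1 : HasDerivAt (fun s => thU τ (s + (1 + τ) / 2)) (deriv (thU τ) (0 + (1 + τ) / 2)) 0 :=
    (thU_diff τ _ hτ).comp_add_const 0 _
  have D2 : HasDerivAt (fun s => thU τ ((1 + τ) / 2 - s)) (-deriv (thU τ) ((1 + τ) / 2 - 0)) 0 :=
    (thU_diff τ _ hτ).comp_const_sub _ 0
  have D3 : HasDerivAt (fun s : ℂ => cexp (-2 * Real.pi * I * s))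
      (cexp (-2 * Real.pi * I * 0) * (-2 * Real.pi * I * 1)) 0 :=
    ((hasDerivAt_id (0 : ℂ)).const_mul _).cexp
  have := D1.unique ((D3.mul D2).congr_of_eventuallyEq (Filter.Eventually.of_forall h))
  simp at this
  linear_combination this / 2

lemma thU_half (τ : ℂ) :
    cexp (Real.pi * I * (τ / 4)) * thU τ ((1 + τ) / 2) = I * jacobiTheta₂ 0 τ := by
  unfold thU
  rw [show (1 + τ) / 2 + (1 + τ) / 2 = 0 + τ + 1 by ring, jacobiTheta₂_add_left,
    jacobiTheta₂_add_left', ← mul_assoc, ← mul_assoc, ← Complex.exp_add, ← Complex.exp_add]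
  congr 1
  refine Eq.trans ?_ cexp_pi_I_half
  congr 1
  ring

open Filter Topology in
lemma lim_aux (g : ℤ → ℂ) (k : ℤ → ℕ) (q : ℂ) (hq : ‖q‖ < 1)
    (hs : Summable fun n => g n * q ^ (k n)) :
    Tendsto (fun m : ℕ => ∑' n, g n * (q ^ (2 ^ m)) ^ (k n)) atTop
      (𝓝 (∑' n, if k n = 0 then g n else 0)) := by
  refine tendsto_tsum_of_dominated_convergence hs.norm ?_ ?_
  · intro n
    by_cases hk : k n = 0
    · simp [hk]
    · have h1 : Tendsto (fun m : ℕ => q ^ (2 ^ m)) atTop (𝓝 0) :=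
        (tendsto_pow_atTop_nhds_zero_of_norm_lt_one hq).comp
          (tendsto_pow_atTop_atTop_of_one_lt (by norm_num : (1 : ℕ) < 2))
      have h2 := (h1.pow (k n)).const_mul (g n)
      simpa [hk] using h2
  · refine Eventually.of_forall fun m n => ?_
    rw [norm_mul, norm_mul, norm_pow, norm_pow, norm_pow]
    gcongr
    have : 2 ^ m ≠ 0 := by positivity
    exact pow_le_of_le_one (norm_nonneg _) hq.le this

lemma im_two_pow (τ : ℂ) (hτ : 0 < τ.im) (m : ℕ) : 0 < (2 ^ m * τ).im := by
  have : (2 ^ m * τ : ℂ) = ((2 ^ m : ℝ) : ℂ) * τ := by push_cast; rfl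
  rw [this, Complex.im_ofReal_mul]
  positivity

open Filter Topology in
lemma lim_aux2 (f : ℂ → ℤ → ℂ) (g : ℤ → ℂ) (k : ℤ → ℕ)
    (hf : ∀ τ n, f τ n = g n * cexp (Real.pi * I * τ) ^ (k n))
    (τ : ℂ) (hτ : 0 < τ.im) (hs : Summable (f τ)) (l : ℂ)
    (hl : (∑' n, if k n = 0 then g n else 0) = l) :
    Tendsto (fun m : ℕ => ∑' n, f (2 ^ m * τ) n) atTop (𝓝 l) := by
  have hq : ‖cexp (Real.pi * I * τ)‖ < 1 := by
    rw [Complex.norm_exp, Real.exp_lt_one_iff]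
    simp only [mul_re, ofReal_re, I_re, mul_zero, ofReal_im, I_im, mul_one, sub_self, mul_im,
      zero_mul, zero_sub, add_zero]
    have := mul_pos Real.pi_pos hτ
    linarith
  have h := lim_aux g k _ hq (by simpa only [← hf] using hs)
  rw [hl] at h
  refine h.congr fun m => tsum_congr fun n => ?_
  rw [hf, ← Complex.exp_nat_mul]
  congr 3
  push_cast
  ring

lemma toNat_cast1 (n : ℤ) : (((n ^ 2).toNat : ℕ) : ℂ) = (n : ℂ) ^ 2 := by
  have : (((n ^ 2).toNat : ℕ) : ℤ) = n ^ 2 := Int.toNat_of_nonneg (by positivity)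
  exact_mod_cast congrArg (Int.cast : ℤ → ℂ) this

lemma nn_aux (n : ℤ) : 0 ≤ n ^ 2 + n := by
  rcases le_or_gt 0 n with h | h <;> nlinarith

lemma toNat_cast2 (n : ℤ) : (((n ^ 2 + n).toNat : ℕ) : ℂ) = (n : ℂ) ^ 2 + n := by
  have : (((n ^ 2 + n).toNat : ℕ) : ℤ) = n ^ 2 + n := Int.toNat_of_nonneg (nn_aux n)
  exact_mod_cast congrArg (Int.cast : ℤ → ℂ) this

lemma toNat_zero1 (n : ℤ) : (n ^ 2).toNat = 0 ↔ n = 0 := by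
  rw [Int.toNat_eq_zero]
  constructor
  · intro h
    have := le_antisymm h (by positivity)
    simpa using this
  · rintro rfl; simp

lemma toNat_zero2 (n : ℤ) : (n ^ 2 + n).toNat = 0 ↔ n = 0 ∨ n = -1 := by
  rw [Int.toNat_eq_zero]
  constructor
  · intro h
    have h1 : n * (n + 1) = 0 := by linarith [le_antisymm h (nn_aux n)]
    rcases mul_eq_zero.1 h1 with h | h
    · exact Or.inl h
    · right; omega
  · rintro (rfl | rfl) <;> simp

lemma tsum1 (g : ℤ → ℂ) : (∑' n : ℤ, if (n ^ 2).toNat = 0 then g n else 0) = g 0 := by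
  simp only [toNat_zero1]
  exact tsum_ite_eq 0 _

lemma tsum2 (g : ℤ → ℂ) :
    (∑' n : ℤ, if (n ^ 2 + n).toNat = 0 then g n else 0) = g 0 + g (-1) := by
  simp only [toNat_zero2]
  rw [tsum_eq_sum (s := {0, -1})]
  · simp
  · intro b hb
    simp only [Finset.mem_insert, Finset.mem_singleton] at hb
    rw [if_neg hb]

open Filter Topology in
lemma lim_C3 (τ : ℂ) (hτ : 0 < τ.im) :
    Tendsto (fun m : ℕ => jacobiTheta₂ 0 (2 ^ m * τ)) atTop (𝓝 1) := by
  refine lim_aux2 (fun τ n => jacobiTheta₂_term n 0 τ) (fun _ => 1) (fun n => (n ^ 2).toNat)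
    ?_ τ hτ ((summable_jacobiTheta₂_term_iff _ _).2 hτ) 1 (tsum1 _)
  intro τ n
  rw [← Complex.exp_nat_mul, toNat_cast1, jacobiTheta₂_term, one_mul]
  congr 1
  ring

open Filter Topology in
lemma lim_C4 (τ : ℂ) (hτ : 0 < τ.im) :
    Tendsto (fun m : ℕ => jacobiTheta₂ (1 / 2) (2 ^ m * τ)) atTop (𝓝 1) := by
  refine lim_aux2 (fun τ n => jacobiTheta₂_term n (1 / 2) τ)
    (fun n => cexp (Real.pi * I * n)) (fun n => (n ^ 2).toNat)
    ?_ τ hτ ((summable_jacobiTheta₂_term_iff _ _).2 hτ) 1 ((tsum1 _).trans (by simp))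
  intro τ n
  rw [← Complex.exp_nat_mul, toNat_cast1, jacobiTheta₂_term, ← Complex.exp_add]
  congr 1
  ring

open Filter Topology in
lemma lim_C2 (τ : ℂ) (hτ : 0 < τ.im) :
    Tendsto (fun m : ℕ => jacobiTheta₂ ((2 ^ m * τ) / 2) (2 ^ m * τ)) atTop (𝓝 2) := by
  refine lim_aux2 (fun τ n => jacobiTheta₂_term n (τ / 2) τ)
    (fun n => 1) (fun n => (n ^ 2 + n).toNat)
    ?_ τ hτ ((summable_jacobiTheta₂_term_iff _ _).2 hτ) 2 ((tsum2 _).trans (by norm_num))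
  intro τ n
  rw [← Complex.exp_nat_mul, toNat_cast2, jacobiTheta₂_term, one_mul]
  congr 1
  ring

open Filter Topology in
lemma lim_P (τ : ℂ) (hτ : 0 < τ.im) :
    Tendsto (fun m : ℕ => jacobiTheta₂' ((1 + 2 ^ m * τ) / 2) (2 ^ m * τ)) atTop
      (𝓝 (2 * Real.pi * I)) := by
  refine lim_aux2 (fun τ n => jacobiTheta₂'_term n ((1 + τ) / 2) τ)
    (fun n => 2 * Real.pi * I * n * cexp (Real.pi * I * n)) (fun n => (n ^ 2 + n).toNat)
    ?_ τ hτ ((summable_jacobiTheta₂'_term_iff _ _).2 hτ) _ ((tsum2 _).trans ?_)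
  · intro τ n
    rw [← Complex.exp_nat_mul, toNat_cast2, jacobiTheta₂'_term, jacobiTheta₂_term, mul_assoc _ (cexp _),
      ← Complex.exp_add]
    congr 2
    ring
  · simp [Complex.exp_neg]

lemma rel_C4 (τ : ℂ) (hτ : 0 < τ.im) :
    jacobiTheta₂ 0 τ * jacobiTheta₂ (1 / 2) τ = jacobiTheta₂ (1 / 2) (2 * τ) ^ 2 := by
  have h := theta_prod (1 / 4) (1 / 4) τ hτ
  have hz := theta_half_zero (2 * τ)
  rw [show (2 : ℂ) * (1 / 4) + τ = (1 + 2 * τ) / 2 by ring, hz, sub_self,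
    show (1 / 4 : ℂ) + 1 / 4 = 1 / 2 by ring, show (2 : ℂ) * (1 / 4) = 1 / 2 by ring] at h
  linear_combination h

lemma rel_C2 (τ : ℂ) (hτ : 0 < τ.im) :
    jacobiTheta₂ (τ / 2) τ ^ 2 = 2 * jacobiTheta₂ ((2 * τ) / 2) (2 * τ) * jacobiTheta₂ 0 (2 * τ) := by
  have h := theta_prod (τ / 2) 0 τ hτ
  rw [show 2 * (τ / 2) + τ = 0 + 2 * τ by ring, jacobiTheta₂_add_left', mul_zero, zero_add,
    ← mul_assoc, ← mul_assoc, ← Complex.exp_add,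
    show Real.pi * I * (τ + 2 * (τ / 2) + 0) + -Real.pi * I * (2 * τ + 0) = 0 by ring,
    Complex.exp_zero, add_zero, sub_zero] at h
  rw [show 2 * τ / 2 = τ by ring]
  rw [show 2 * (τ / 2) = τ by ring] at h
  linear_combination h

lemma rel_P (τ : ℂ) (hτ : 0 < τ.im) :
    jacobiTheta₂' ((1 + τ) / 2) τ * jacobiTheta₂ (τ / 2) τ =
      2 * jacobiTheta₂' ((1 + 2 * τ) / 2) (2 * τ) * jacobiTheta₂ (1 / 2) (2 * τ) := by
  have hτ2 : 0 < (2 * τ).im := by simpa using hτ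
  have h : ∀ z : ℂ, jacobiTheta₂ (z + (1 + τ) / 2) τ * jacobiTheta₂ (z + τ / 2) τ =
      jacobiTheta₂ (2 * z + (1 + 2 * τ) / 2) (2 * τ) * jacobiTheta₂ (1 / 2) (2 * τ) := by
    intro z
    have h := theta_prod (z + τ / 2 + 1 / 4) (1 / 4) τ hτ
    rw [show (2 : ℂ) * (1 / 4) + τ = (1 + 2 * τ) / 2 by ring, theta_half_zero,
      show (2 : ℂ) * (1 / 4) = 1 / 2 by ring,
      show z + τ / 2 + 1 / 4 + 1 / 4 = z + (1 + τ) / 2 by ring,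
      show z + τ / 2 + 1 / 4 - 1 / 4 = z + τ / 2 by ring,
      show 2 * (z + τ / 2 + 1 / 4) = 2 * z + (1 + 2 * τ) / 2 by ring] at h
    linear_combination h
  have D1 := ((hasDerivAt_jacobiTheta₂_fst (0 + (1 + τ) / 2) hτ).comp_add_const 0 _).mul
    ((hasDerivAt_jacobiTheta₂_fst (0 + τ / 2) hτ).comp_add_const 0 _)
  have D3 : HasDerivAt (fun z : ℂ => 2 * z + (1 + 2 * τ) / 2) (2 * 1) 0 :=
    ((hasDerivAt_id (0 : ℂ)).const_mul 2).add_const _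
  have D2 := (HasDerivAt.comp (0 : ℂ)
    (hasDerivAt_jacobiTheta₂_fst (2 * 0 + (1 + 2 * τ) / 2) hτ2) D3).mul_const
      (jacobiTheta₂ (1 / 2) (2 * τ))
  have := D1.unique (D2.congr_of_eventuallyEq (Filter.Eventually.of_forall h))
  simp only [zero_add, mul_zero, theta_half_zero] at this
  linear_combination this

open Filter Topology in
lemma C4_ne (τ : ℂ) (hτ : 0 < τ.im) : jacobiTheta₂ (1 / 2) τ ≠ 0 := by
  intro h0
  have h : ∀ m : ℕ, jacobiTheta₂ (1 / 2) (2 ^ m * τ) = 0 := by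
    intro m
    induction m with
    | zero => simpa using h0
    | succ m ih =>
      have := rel_C4 _ (im_two_pow τ hτ m)
      rw [ih, mul_zero] at this
      rw [pow_succ', mul_assoc]
      exact pow_eq_zero_iff (two_ne_zero) |>.1 this.symm
  have h1 := lim_C4 τ hτ
  simp only [h] at h1
  exact zero_ne_one (tendsto_nhds_unique tendsto_const_nhds h1)

lemma C3_ne (τ : ℂ) (hτ : 0 < τ.im) : jacobiTheta₂ 0 τ ≠ 0 := by
  intro h0
  have := rel_C4 τ hτ
  rw [h0, zero_mul] at this
  exact C4_ne (2 * τ) (by simpa using hτ) (pow_eq_zero_iff (two_ne_zero) |>.1 this.symm)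

open Filter Topology in
lemma C2_ne (τ : ℂ) (hτ : 0 < τ.im) : jacobiTheta₂ (τ / 2) τ ≠ 0 := by
  intro h0
  have h : ∀ m : ℕ, jacobiTheta₂ ((2 ^ m * τ) / 2) (2 ^ m * τ) = 0 := by
    intro m
    induction m with
    | zero => simpa using h0
    | succ m ih =>
      have := rel_C2 _ (im_two_pow τ hτ m)
      have h3 := C3_ne _ (im_two_pow τ hτ (m + 1))
      rw [pow_succ', mul_assoc] at h3 ⊢
      rw [ih] at this
      simpa [h3] using this
  have h1 := lim_C2 τ hτ
  simp only [h] at h1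
  exact two_ne_zero (tendsto_nhds_unique tendsto_const_nhds h1).symm

noncomputable def thD (τ : ℂ) : ℂ :=
  jacobiTheta₂' ((1 + τ) / 2) τ /
    (jacobiTheta₂ (τ / 2) τ * jacobiTheta₂ 0 τ * jacobiTheta₂ (1 / 2) τ)

lemma thD_two (τ : ℂ) (hτ : 0 < τ.im) : thD (2 * τ) = thD τ := by
  have hτ2 : 0 < (2 * τ).im := by simpa using hτ
  have a2 := C2_ne τ hτ
  have a3 := C3_ne τ hτ
  have a4 := C4_ne τ hτ
  have b2 := C2_ne _ hτ2
  have b3 := C3_ne _ hτ2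
  have b4 := C4_ne _ hτ2
  have r1 := rel_P τ hτ
  have r2 := rel_C2 τ hτ
  have r4 := rel_C4 τ hτ
  unfold thD
  rw [div_eq_div_iff (mul_ne_zero (mul_ne_zero b2 b3) b4) (mul_ne_zero (mul_ne_zero a2 a3) a4)]
  generalize jacobiTheta₂' ((1 + τ) / 2) τ = P at *
  generalize jacobiTheta₂' ((1 + 2 * τ) / 2) (2 * τ) = P' at *
  generalize jacobiTheta₂ (τ / 2) τ = x2 at *
  generalize jacobiTheta₂ 0 τ = x3 at *
  generalize jacobiTheta₂ (1 / 2) τ = x4 at *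
  generalize jacobiTheta₂ (2 * τ / 2) (2 * τ) = y2 at *
  generalize jacobiTheta₂ 0 (2 * τ) = y3 at *
  generalize jacobiTheta₂ (1 / 2) (2 * τ) = y4 at *
  apply mul_left_cancel₀ (mul_ne_zero two_ne_zero a2)
  linear_combination (2 * P' * x2 ^ 2) * r4 - x2 ^ 2 * y4 * r1 + P * x2 * y4 * r2

open Filter Topology in
lemma thD_eq (τ : ℂ) (hτ : 0 < τ.im) : thD τ = Real.pi * I := by
  have h : ∀ m : ℕ, thD (2 ^ m * τ) = thD τ := by
    intro m
    induction m with
    | zero => simp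
    | succ m ih => rw [pow_succ', mul_assoc, thD_two _ (im_two_pow τ hτ m), ih]
  have h1 := (lim_P τ hτ).div (((lim_C2 τ hτ).mul (lim_C3 τ hτ)).mul (lim_C4 τ hτ)) (by norm_num)
  have h2 : Tendsto (fun m : ℕ => thD (2 ^ m * τ)) atTop
    (𝓝 (2 * Real.pi * I / (2 * 1 * 1))) := h1
  simp only [h] at h2
  rw [tendsto_nhds_unique tendsto_const_nhds h2]
  ring

lemma jacobi_deriv (τ : ℂ) (hτ : 0 < τ.im) :
    deriv (thU τ) 0 = cexp (Real.pi * I * (τ / 4)) * (Real.pi * I) *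
      (jacobiTheta₂ (τ / 2) τ * jacobiTheta₂ 0 τ * jacobiTheta₂ (1 / 2) τ) := by
  have h := thD_eq τ hτ
  unfold thD at h
  rw [div_eq_iff (mul_ne_zero (mul_ne_zero (C2_ne τ hτ) (C3_ne τ hτ)) (C4_ne τ hτ))] at h
  rw [mul_assoc, ← h]
  have D1 := (hasDerivAt_jacobiTheta₂_fst (0 + (1 + τ) / 2) hτ).comp_add_const 0 _
  have D2 : HasDerivAt (fun u : ℂ => cexp (Real.pi * I * (τ / 4 + u)))
      (cexp (Real.pi * I * (τ / 4 + 0)) * (Real.pi * I * 1)) 0 :=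
    (((hasDerivAt_id (0 : ℂ)).const_add (τ / 4)).const_mul _).cexp
  have D3 : HasDerivAt (thU τ) _ 0 := D2.mul D1
  rw [D3.deriv]
  simp [theta_half_zero]

lemma char_eq (a b : ℝ) (z τ : ℂ) :
    jacobiThetaChar a b z τ = cexp (Real.pi * I * (a ^ 2 * τ + 2 * a * (z + b))) *
      jacobiTheta₂ (z + b + a * τ) τ := by
  unfold jacobiThetaChar jacobiTheta₂
  rw [← tsum_mul_left]
  refine tsum_congr fun n => ?_
  rw [jacobiTheta₂_term, ← Complex.exp_add]
  congr 1
  ring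

theorem theta_derivative_third_third (τ : ℂ) (hτ : 0 < τ.im) :
    jacobiThetaCharDeriv (1 / 3) (1 / 3) τ * jacobiThetaChar (1 / 3) (1 / 3) 0 τ ^ 2 =
      -((Real.pi : ℂ) / 3) * jacobiThetaChar (1 / 2) 0 0 τ *
        jacobiThetaChar 0 (1 / 2) 0 τ * jacobiThetaChar (1 / 6) (1 / 6) 0 τ ^ 3 := by
  have hT : ∀ z, jacobiThetaChar (1 / 3) (1 / 3) z τ =
      cexp (Real.pi * I * (τ / 36 + 7 / 18)) * cexp (Real.pi * I * (-z / 3)) *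
        thU τ (z - (1 + τ) / 6) := by
    intro z
    rw [char_eq]
    unfold thU
    rw [← mul_assoc, ← Complex.exp_add, ← Complex.exp_add]
    push_cast
    congr 2 <;> ring
  have h0 := hT 0
  have hD : jacobiThetaCharDeriv (1 / 3) (1 / 3) τ = cexp (Real.pi * I * (τ / 36 + 7 / 18)) *
      (deriv (thU τ) ((1 + τ) / 6) + Real.pi * I / 3 * thU τ ((1 + τ) / 6)) := by
    unfold jacobiThetaCharDeriv
    rw [funext hT]
    have D1 : HasDerivAt (fun z : ℂ => thU τ (z - (1 + τ) / 6)) _ 0 :=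
      (thU_diff τ (0 - (1 + τ) / 6) hτ).comp_sub_const 0 _
    have D2 : HasDerivAt (fun z : ℂ => cexp (Real.pi * I * (-z / 3)))
      (cexp (Real.pi * I * (-0 / 3)) * (Real.pi * I * (-1 / 3))) 0 :=
      ((((hasDerivAt_id (0 : ℂ)).neg).div_const 3).const_mul _).cexp
    have D3 := (D2.const_mul (cexp (Real.pi * I * (τ / 36 + 7 / 18)))).mul D1
    refine D3.deriv.trans ?_
    rw [zero_sub, thU_neg, thU_deriv_neg _ _ hτ]
    simp
    ring
  have k := thU_key τ ((1 + τ) / 6) hτ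
  rw [show 3 * ((1 + τ) / 6) = (1 + τ) / 2 by ring, thU_deriv_half τ hτ, jacobi_deriv τ hτ] at k
  have kh := thU_half τ
  have c2 : jacobiThetaChar (1 / 2) 0 0 τ =
      cexp (Real.pi * I * (τ / 4)) * jacobiTheta₂ (τ / 2) τ := by
    rw [char_eq]
    push_cast
    congr 2 <;> ring
  have c4 : jacobiThetaChar 0 (1 / 2) 0 τ = jacobiTheta₂ (1 / 2) τ := by
    rw [char_eq]
    simp
  have c6 : cexp (Real.pi * I * (τ / 36 + 7 / 18)) * thU τ (2 * ((1 + τ) / 6)) =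
      cexp (Real.pi * I * (-τ / 12 + 1)) * jacobiThetaChar (1 / 6) (1 / 6) 0 τ := by
    rw [char_eq]
    unfold thU
    rw [show 2 * ((1 + τ) / 6) + (1 + τ) / 2 = -((1 + τ) / 6) + τ + 1 by ring,
      jacobiTheta₂_add_left, jacobiTheta₂_add_left', jacobiTheta₂_neg_left,
      ← mul_assoc, ← mul_assoc, ← mul_assoc, ← Complex.exp_add, ← Complex.exp_add,
      ← Complex.exp_add]
    push_cast
    congr 2 <;> ring
  have hE : cexp (Real.pi * I * (-τ / 12 + 1)) ^ 3 * cexp (Real.pi * I * (τ / 4)) = -1 := by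
    rw [← Complex.exp_nat_mul, ← Complex.exp_add, ← Complex.exp_pi_mul_I, Complex.exp_eq_exp_iff_exists_int]
    exact ⟨1, by push_cast; ring⟩
  have hn : 3 * (cexp (Real.pi * I * (τ / 4)) * thU τ ((1 + τ) / 2)) ≠ 0 := by
    rw [kh]
    exact mul_ne_zero three_ne_zero (mul_ne_zero I_ne_zero (C3_ne τ hτ))
  rw [zero_sub, thU_neg, neg_zero, zero_div, mul_zero, Complex.exp_zero, mul_one] at h0
  rw [hD, h0, c2, c4]
  have c63 := congrArg (fun x => x ^ 3) c6
  simp only [mul_pow] at c63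
  apply mul_left_cancel₀ hn
  generalize cexp (Real.pi * I * (-τ / 12 + 1)) = E at *
  generalize cexp (Real.pi * I * (τ / 36 + 7 / 18)) = c at *
  generalize cexp (Real.pi * I * (τ / 4)) = e at *
  generalize thU τ ((1 + τ) / 2) = w at *
  generalize thU τ (2 * ((1 + τ) / 6)) = v at *
  generalize thU τ ((1 + τ) / 6) = m at *
  generalize deriv (thU τ) ((1 + τ) / 6) = d at *
  generalize jacobiThetaChar (1 / 6) (1 / 6) 0 τ = s at *
  generalize jacobiTheta₂ (τ / 2) τ = x2 at *
  generalize jacobiTheta₂ 0 τ = x3 at *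
  generalize jacobiTheta₂ (1 / 2) τ = x4 at *
  linear_combination c ^ 3 * e * k + e ^ 2 * Real.pi * I * x2 * x3 * x4 * c63 +
    s ^ 3 * e * Real.pi * I * x2 * x3 * x4 * hE + Real.pi * e * x2 * x4 * s ^ 3 * kh
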